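/- Let K be a field and R a commutative K-algebra. Let A and B be commutative K-algebras equipped with K-linear functionals τ_A : A → K and τ_B : B → K whose induced multiplication pairings (x,y) ↦ τ_A(x·y) on A and (x,y) ↦ τ_B(x·y) on B are nondegenerate. Let ξ_v : R → A and ξ_w : R → B be surjective K-algebra homomorphisms, and let φ : R → R be a K-algebra automorphism satisfying τ_B(ξ_w(φ(d))) = τ_A(ξ_v(d)) for all d ∈ R. Let f : R → R be a K-algebra automorphism that descends along ξ_v, i.e. there exists a ring isomorphism f̃ : A → A with f̃ ∘ ξ_v = ξ_v ∘ f. Then the automorphism g := φ ∘ f ∘ φ⁻¹ of R descends along ξ_w: there exists a ring isomorphism g̃ : B → B with g̃ ∘ ξ_w = ξ_w ∘ g. -/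

import Mathlib

/-- Two surjective ring homomorphisms with the same kernel have isomorphic targets, compatibly
with the homomorphisms. -/
theorem RingHom.exists_ringEquiv_of_ker_eq {R A B : Type*} [CommRing R] [CommRing A] [CommRing B]
    {f : R →+* A} {g : R →+* B} (hf : Function.Surjective f) (hg : Function.Surjective g)
    (h : RingHom.ker f = RingHom.ker g) : ∃ e : A ≃+* B, ∀ r, e (f r) = g r := by
  refine ⟨(RingHom.quotientKerEquivOfSurjective hf).symm.trans
    ((Ideal.quotEquivOfEq h).trans (RingHom.quotientKerEquivOfSurjective hg)), fun r => ?_⟩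
  have hr : (RingHom.quotientKerEquivOfSurjective hf).symm (f r) = Ideal.Quotient.mk _ r := by
    rw [RingEquiv.symm_apply_eq]
    rfl
  rw [RingEquiv.trans_apply, hr]
  rfl

/-- The kernel of a surjection onto an algebra with nondegenerate multiplication pairing is
determined by the pulled-back functional. -/
theorem AlgHom.eq_zero_iff_forall_pairing_eq_zero {K R A : Type*} [CommRing K] [CommRing R]
    [CommRing A] [Algebra K R] [Algebra K A] {τ : A →ₗ[K] K}
    (hτ : ∀ x : A, (∀ y : A, τ (x * y) = 0) → x = 0) {ξ : R →ₐ[K] A}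
    (hξ : Function.Surjective ξ) (d : R) : ξ d = 0 ↔ ∀ e : R, τ (ξ (d * e)) = 0 := by
  refine ⟨fun h e => by simp [h], fun h => hτ _ fun y => ?_⟩
  obtain ⟨e, rfl⟩ := hξ y
  rw [← map_mul, h]


/-- Lemma 5.1 of the paper, algebraic content. With `K`, `R`,
`A`, `B`, `τ_A`, `τ_B`, `ξ_v`, `ξ_w`, `φ` as in Statement 1, if a `K`-algebra
automorphism `f : R → R` descends along `ξ_v` (i.e. there is a ring isomorphism
`f̃ : A → A` with `f̃ ∘ ξ_v = ξ_v ∘ f`), then `g := φ ∘ f ∘ φ⁻¹` descends along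
`ξ_w`: there is a ring isomorphism `g̃ : B → B` with `g̃ ∘ ξ_w = ξ_w ∘ g`. -/
theorem conjugate_automorphism_descends
    (K R A B : Type*) [Field K] [CommRing R] [CommRing A] [CommRing B]
    [Algebra K R] [Algebra K A] [Algebra K B]
    (τA : A →ₗ[K] K) (τB : B →ₗ[K] K)
    (hA : ∀ x : A, (∀ y : A, τA (x * y) = 0) → x = 0)
    (hB : ∀ x : B, (∀ y : B, τB (x * y) = 0) → x = 0)
    (ξv : R →ₐ[K] A) (ξw : R →ₐ[K] B)
    (hv : Function.Surjective ξv) (hw : Function.Surjective ξw)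
    (φ : R ≃ₐ[K] R)
    (hφ : ∀ d : R, τB (ξw (φ d)) = τA (ξv d))
    (f : R ≃ₐ[K] R)
    (hf : ∃ ftilde : A ≃+* A, ∀ r : R, ftilde (ξv r) = ξv (f r)) :
    ∃ gtilde : B ≃+* B, ∀ r : R, gtilde (ξw r) = ξw (φ (f (φ.symm r))) := by
  obtain ⟨ftilde, hf⟩ := hf
  have hwφ : Function.Surjective (ξw.comp φ.toAlgHom) := hw.comp φ.surjective
  have hker : RingHom.ker ξv.toRingHom = RingHom.ker (ξw.comp φ.toAlgHom).toRingHom := by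
    ext d
    change ξv d = 0 ↔ (ξw.comp φ.toAlgHom) d = 0
    rw [AlgHom.eq_zero_iff_forall_pairing_eq_zero hA hv,
      AlgHom.eq_zero_iff_forall_pairing_eq_zero hB hwφ]
    exact forall_congr' fun e => by rw [← hφ]; rfl
  obtain ⟨θ, hθ⟩ := RingHom.exists_ringEquiv_of_ker_eq (f := ξv.toRingHom)
    (g := (ξw.comp φ.toAlgHom).toRingHom) hv hwφ hker
  replace hθ : ∀ r, θ (ξv r) = ξw (φ r) := hθ
  refine ⟨θ.symm.trans (ftilde.trans θ), fun r => ?_⟩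
  have hr : θ.symm (ξw r) = ξv (φ.symm r) := by
    rw [RingEquiv.symm_apply_eq, hθ, φ.apply_symm_apply]
  rw [RingEquiv.trans_apply, RingEquiv.trans_apply, hr, hf, hθ]
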